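/- Let m, k be positive integers and let H be a finite group. Then any subset S of size k of (Z_m × H) \ {0} is weakly Freiman isomorphic (of order k) to a subset S' of size k of (Z × H) \ {0}, provided that every prime factor of m is greater than k!/2. -/

import Mathlib

/-- `f` is a weak Freiman homomorphism of order `k` from `S` (in the ambient group `V`)
to `S'` (in the ambient group `W`). -/
def IsWeakFreimanHom {V W : Type*} [Group V] [Group W] (k : ℕ)
    (S : Finset V) (S' : Finset W) (f : V → W) : Prop :=
  (∀ x ∈ S, f x ∈ S') ∧
    ∀ l : List V, l.Nodup → (∀ x ∈ l, x ∈ S) → l.length ≤ k →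
      l.prod = 1 → (l.map f).prod = 1

/-- `f` is a weak Freiman isomorphism of order `k` from `S` to `S'`. -/
def IsWeakFreimanIso {V W : Type*} [Group V] [Group W] (k : ℕ)
    (S : Finset V) (S' : Finset W) (f : V → W) : Prop :=
  Set.BijOn f ↑S ↑S' ∧ IsWeakFreimanHom k S S' f ∧
    ∃ g : W → V, (∀ x ∈ S, g (f x) = x) ∧ (∀ y ∈ S', f (g y) = y) ∧
      IsWeakFreimanHom k S' S g

open Finset Matrix

theorem two_mul_abs_det_le_factorial {ι : Type*} [Fintype ι] [DecidableEq ι] [Nontrivial ι]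
    (A : Matrix ι ι ℤ) (hA : ∀ i j, A i j = 0 ∨ A i j = 1) :
    2 * |A.det| ≤ (Nat.factorial (Fintype.card ι) : ℤ) := by
  have hone : (Matrix.of fun _ _ : ι => (1 : ℤ)).det = 0 := by
    obtain ⟨i, j, hij⟩ := exists_pair_ne ι
    exact Matrix.det_zero_of_row_eq hij rfl
  have hdet : 2 * A.det =
      ∑ σ : Equiv.Perm ι, ((Equiv.Perm.sign σ : ℤˣ) : ℤ) * (2 * ∏ i, A (σ i) i - 1) := by
    rw [Matrix.det_apply'] at hone
    simp only [Matrix.of_apply, prod_const_one, mul_one, Int.cast_id] at hone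
    rw [Matrix.det_apply']
    simp only [mul_sub, mul_one, sum_sub_distrib, hone, sub_zero, mul_sum, Int.cast_id]
    exact sum_congr rfl fun σ _ => by ring
  have hprod : ∀ σ : Equiv.Perm ι, ∏ i, A (σ i) i = 0 ∨ ∏ i, A (σ i) i = 1 := by
    intro σ
    by_cases h : ∃ i, A (σ i) i = 0
    · obtain ⟨i, hi⟩ := h
      exact Or.inl (prod_eq_zero (mem_univ i) hi)
    · push Not at h
      exact Or.inr (prod_eq_one fun i _ => (hA _ _).resolve_left (h i))
  calc 2 * |A.det| = |2 * A.det| := by rw [abs_mul]; norm_num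
    _ ≤ ∑ σ : Equiv.Perm ι, |((Equiv.Perm.sign σ : ℤˣ) : ℤ) * (2 * ∏ i, A (σ i) i - 1)| := by
      rw [hdet]; exact abs_sum_le_sum_abs _ _
    _ ≤ ∑ _σ : Equiv.Perm ι, (1 : ℤ) := by
      refine sum_le_sum fun σ _ => ?_
      rw [abs_mul, Int.isUnit_iff_abs_eq.1 (Units.isUnit _), one_mul]
      rcases hprod σ with h | h <;> rw [h] <;> norm_num
    _ = (Nat.factorial (Fintype.card ι) : ℤ) := by
      simp [Fintype.card_perm]

theorem isUnit_det_zmod {ι : Type*} [Fintype ι] [DecidableEq ι] {m : ℕ}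
    (hprime : ∀ p : ℕ, p.Prime → p ∣ m → Nat.factorial (Fintype.card ι) < 2 * p)
    (A : Matrix ι ι ℤ) (hA : ∀ i j, A i j = 0 ∨ A i j = 1) (hdet : A.det ≠ 0) :
    IsUnit ((A.det : ℤ) : ZMod m) := by
  have hcop : A.det.natAbs.Coprime m := by
    refine Nat.coprime_of_dvd fun p hp hpd hpm => ?_
    have hle := Nat.le_of_dvd (Int.natAbs_pos.2 hdet) hpd
    rcases subsingleton_or_nontrivial ι with hι | hι
    · have h1 : A.det.natAbs ≤ 1 := by
        rcases isEmpty_or_nonempty ι with h | ⟨⟨i⟩⟩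
        · simp
        · rw [Matrix.det_eq_elem_of_subsingleton A i]
          rcases hA i i with h | h <;> simp [h]
      have := hp.two_le
      omega
    · have h1 := two_mul_abs_det_le_factorial A hA
      have h2 := hprime p hp hpm
      rw [Int.abs_eq_natAbs] at h1
      omega
  have hu := (ZMod.isUnit_iff_coprime _ _).2 hcop
  rcases Int.natAbs_eq A.det with h | h <;> rw [h]
  · simpa using hu
  · simpa using hu.neg

/-- The indicator vector of a finite set of coordinates. -/
def indicatorVec (R : Type*) [Zero R] [One R] {ι : Type*} [DecidableEq ι] (I : Finset ι) :
    ι → R :=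
  fun i => if i ∈ I then 1 else 0

theorem exists_indicator_matrix {ι : Type*} [Fintype ι] [DecidableEq ι]
    (𝓘 : Set (Finset ι)) :
    ∃ e : ι → Finset ι, (Matrix.of fun i => indicatorVec ℤ (e i)).det ≠ 0 ∧
      ∀ v ∈ Submodule.span ℚ (indicatorVec ℚ '' 𝓘), ∃ c : ι → ℚ,
        (∀ i, e i ∉ 𝓘 → c i = 0) ∧ v = c ᵥ* (Matrix.of fun i => indicatorVec ℚ (e i)) := by
  obtain ⟨s, hs𝓘, -, hspan, hs⟩ := exists_linearIndepOn_extension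
    (linearIndepOn_empty ℚ (indicatorVec ℚ : Finset ι → ι → ℚ)) (Set.empty_subset 𝓘)
  obtain ⟨b, -, hsb, hbspan, hb⟩ := exists_linearIndepOn_extension hs (Set.subset_univ s)
  have htop : ⊤ ≤ Submodule.span ℚ (Set.range fun x : b => indicatorVec ℚ x.1) := by
    rw [← (Pi.basisFun ℚ ι).span_eq, Submodule.span_le]
    rintro _ ⟨i, rfl⟩
    have h := hbspan ⟨{i}, trivial, rfl⟩
    rw [Set.image_eq_range] at h
    convert h using 1
    ext j
    simp [indicatorVec, Pi.single_apply]
  let B := Module.Basis.mk hb.linearIndependent htop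
  let e : ι ≃ b := (Pi.basisFun ℚ ι).indexEquiv B
  have hli : LinearIndependent ℚ (Matrix.of fun i => indicatorVec ℚ (e i).1).row :=
    hb.linearIndependent.comp e e.injective
  rw [Matrix.linearIndependent_rows_iff_isUnit, Matrix.isUnit_iff_isUnit_det] at hli
  refine ⟨fun i => (e i).1, fun h0 => hli.ne_zero ?_, fun v hv => ?_⟩
  · have := congrArg (Int.castRingHom ℚ) h0
    rw [RingHom.map_det] at this
    rw [map_zero] at this
    rw [← this]
    congr 1
    ext i j
    simp [indicatorVec]
  · have hv' := Submodule.span_le.2 hspan hv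
    rw [Finsupp.mem_span_image_iff_linearCombination] at hv'
    obtain ⟨l, hl, rfl⟩ := hv'
    rw [Finsupp.mem_supported] at hl
    refine ⟨fun i => l (e i).1, fun i hi => ?_, ?_⟩
    · by_contra h
      exact hi (hs𝓘 (hl (by simpa using h)))
    · rw [Matrix.vecMul_eq_sum, Finsupp.linearCombination_apply,
        Finsupp.sum_of_support_subset l (s := univ.image fun i => (e i).1) _ _ (by simp),
        sum_image fun i _ j _ h => e.injective (Subtype.ext h)]
      · rfl
      · intro I hI
        exact mem_image.2 ⟨e.symm ⟨I, hsb (hl hI)⟩, mem_univ _, by simp⟩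

theorem sum_mul_eq_zero_of_mem_span {ι : Type*} [Fintype ι] [DecidableEq ι] {m : ℕ}
    (hprime : ∀ p : ℕ, p.Prime → p ∣ m → Nat.factorial (Fintype.card ι) < 2 * p)
    (x : ι → ZMod m) (v : ι → ℤ)
    (hv : (fun i => (v i : ℚ)) ∈
      Submodule.span ℚ (indicatorVec ℚ '' {I : Finset ι | ∑ i ∈ I, x i = 0})) :
    ∑ i, (v i : ZMod m) * x i = 0 := by
  obtain ⟨e, hdet, he⟩ := exists_indicator_matrix {I : Finset ι | ∑ i ∈ I, x i = 0}
  obtain ⟨c, hc, hvc⟩ := he _ hv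
  set A : Matrix ι ι ℤ := Matrix.of fun i => indicatorVec ℤ (e i) with hA
  have hAQ : (Matrix.of fun i => indicatorVec ℚ (e i)) = A.map (Int.castRingHom ℚ) := by
    ext i j
    simp [hA, indicatorVec]
  have hunit : IsUnit ((A.det : ℤ) : ZMod m) := by
    refine isUnit_det_zmod hprime A (fun i j => ?_) hdet
    simp only [hA, Matrix.of_apply, indicatorVec]
    split_ifs <;> simp
  have hw : ∀ i, (((v ᵥ* A.adjugate) i : ℤ) : ℚ) = A.det * c i := by
    intro i
    have h2 : (Int.castRingHom ℚ ∘ v) = c ᵥ* A.map (Int.castRingHom ℚ) := by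
      rw [← hAQ, ← hvc]; rfl
    have h3 : A.adjugate.map (Int.castRingHom ℚ) = (A.map (Int.castRingHom ℚ)).adjugate :=
      RingHom.map_adjugate _ _
    have h4 : (A.map (Int.castRingHom ℚ)).det = A.det := (RingHom.map_det _ _).symm
    have h0 := RingHom.map_vecMul (Int.castRingHom ℚ) A.adjugate v i
    rw [h2, h3, Matrix.vecMul_vecMul, Matrix.mul_adjugate, h4, Matrix.vecMul_smul,
      Matrix.vecMul_one] at h0
    simpa using h0
  have hterm : ∀ i, ((v ᵥ* A.adjugate) i : ZMod m) * ∑ j, (A i j : ZMod m) * x j = 0 := by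
    intro i
    by_cases hi : ∑ j ∈ e i, x j = 0
    · have : ∑ j, (A i j : ZMod m) * x j = ∑ j ∈ e i, x j := by
        simp [hA, indicatorVec, ite_mul, sum_ite_mem]
      rw [this, hi, mul_zero]
    · have h := hw i
      rw [hc i hi, mul_zero] at h
      rw [Int.cast_eq_zero.1 h, Int.cast_zero, zero_mul]
  have hdv : ∀ j, A.det * v j = ∑ i, (v ᵥ* A.adjugate) i * A i j := by
    intro j
    have h : (v ᵥ* A.adjugate) ᵥ* A = A.det • v := by
      rw [Matrix.vecMul_vecMul, Matrix.adjugate_mul, Matrix.vecMul_smul, Matrix.vecMul_one]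
    exact (congrFun h j).symm
  refine hunit.mul_right_eq_zero.1 ?_
  calc ((A.det : ℤ) : ZMod m) * ∑ j, (v j : ZMod m) * x j
      = ∑ j, ((A.det * v j : ℤ) : ZMod m) * x j := by
        rw [mul_sum]
        exact sum_congr rfl fun j _ => by push_cast; ring
    _ = ∑ j, ∑ i, ((v ᵥ* A.adjugate) i : ZMod m) * ((A i j : ZMod m) * x j) := by
        refine sum_congr rfl fun j _ => ?_
        rw [hdv, Int.cast_sum, sum_mul]
        exact sum_congr rfl fun i _ => by push_cast; ring
    _ = 0 := by
        rw [sum_comm]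
        exact sum_eq_zero fun i _ => by rw [← mul_sum]; exact hterm i

/-- A linear functional vanishing on a subspace but on none of finitely many integer vectors
outside it can be taken with integer coefficients. -/
theorem exists_int_functional {ι κ : Type*} [Fintype ι] [DecidableEq ι] [Finite κ]
    (W : Submodule ℚ (ι → ℚ)) (v : κ → ι → ℤ) :
    ∃ y : ι → ℤ, ∀ a, (∑ i, v a i * y i = 0 ↔ (fun i => (v a i : ℚ)) ∈ W) := by
  let vQ : κ → ι → ℚ := fun a i => v a i
  obtain ⟨f, hf⟩ := Module.exists_dual_forall_apply_ne_zero (K := ℚ)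
    (fun a : {a : κ // vQ a ∉ W} => W.mkQ (vQ a))
    (fun a => by simpa using a.2)
  obtain ⟨d, hd⟩ := IsLocalization.exist_integer_multiples_of_finite (nonZeroDivisors ℤ)
    (fun i : ι => f (W.mkQ (Pi.single i 1)))
  choose y hy using hd
  have hd0 : ((d : ℤ) : ℚ) ≠ 0 := by
    exact_mod_cast nonZeroDivisors.ne_zero d.2
  have key : ∀ a, ((∑ i, v a i * y i : ℤ) : ℚ) = (d : ℤ) * f (W.mkQ (vQ a)) := by
    intro a
    have hva : vQ a = ∑ i, (v a i : ℚ) • (Pi.single i (1 : ℚ) : ι → ℚ) := by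
      ext j
      simp [vQ, Pi.single_apply]
    rw [hva, map_sum, map_sum, mul_sum, Int.cast_sum]
    refine sum_congr rfl fun i _ => ?_
    have h := hy i
    simp only [algebraMap_int_eq, eq_intCast, zsmul_eq_mul] at h
    rw [Int.cast_mul, h, map_smul, map_smul, smul_eq_mul]
    ring
  refine ⟨y, fun a => ?_⟩
  rw [← Int.cast_eq_zero (α := ℚ), key, mul_eq_zero, or_iff_right hd0]
  constructor
  · intro h
    by_contra hn
    exact hf ⟨a, hn⟩ h
  · intro h
    have : W.mkQ (vQ a) = 0 := by simpa using h
    rw [this, map_zero]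

theorem exists_int_lift {ι : Type*} [Fintype ι] [DecidableEq ι] {m : ℕ}
    (hprime : ∀ p : ℕ, p.Prime → p ∣ m → Nat.factorial (Fintype.card ι) < 2 * p)
    (x : ι → ZMod m) :
    ∃ y : ι → ℤ, (∀ I : Finset ι, ∑ i ∈ I, x i = 0 ↔ ∑ i ∈ I, y i = 0) ∧
      ∀ i j, y i = y j → x i = x j := by
  set W := Submodule.span ℚ (indicatorVec ℚ '' {I : Finset ι | ∑ i ∈ I, x i = 0})
  obtain ⟨y, hy⟩ := exists_int_functional W
    (Sum.elim (indicatorVec ℤ) fun p : ι × ι => Pi.single p.1 1 - Pi.single p.2 1)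
  refine ⟨y, fun I => ?_, fun i j hij => ?_⟩
  · have h := hy (Sum.inl I)
    have hI : (∑ i, indicatorVec ℤ I i * y i) = ∑ i ∈ I, y i := by
      simp [indicatorVec, sum_ite_mem]
    rw [Sum.elim_inl, hI] at h
    rw [h]
    constructor
    · intro hx
      refine Submodule.subset_span ⟨I, hx, ?_⟩
      ext i
      simp [indicatorVec]
    · intro hW
      have := sum_mul_eq_zero_of_mem_span hprime x _ hW
      simpa [indicatorVec, sum_ite_mem] using this
  · have h := hy (Sum.inr (i, j))
    have hW := h.1 (by simp [sub_mul, sum_sub_distrib, Pi.single_apply, hij])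
    have := sum_mul_eq_zero_of_mem_span hprime x _ hW
    simpa [sub_mul, sum_sub_distrib, Pi.single_apply, sub_eq_zero] using this

theorem list_prod_eq_one_iff {M N : Type*} [Monoid M] [Monoid N] (l : List (M × N)) :
    l.prod = 1 ↔ (l.map Prod.fst).prod = 1 ∧ (l.map Prod.snd).prod = 1 := by
  have hfst : l.prod.1 = (l.map Prod.fst).prod := map_list_prod (MonoidHom.fst M N) l
  have hsnd : l.prod.2 = (l.map Prod.snd).prod := map_list_prod (MonoidHom.snd M N) l
  rw [Prod.ext_iff, hfst, hsnd, Prod.fst_one, Prod.snd_one]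

theorem isWeakFreimanIso_image {V W : Type*} [Group V] [Group W] [DecidableEq W] (k : ℕ)
    (S : Finset V) (f : V → W) (hf : Set.InjOn f S)
    (h : ∀ l : List V, l.Nodup → (∀ x ∈ l, x ∈ S) → (l.prod = 1 ↔ (l.map f).prod = 1)) :
    IsWeakFreimanIso k S (S.image f) f := by
  have hg : Set.LeftInvOn (Function.invFunOn f S) f S := hf.leftInvOn_invFunOn
  have hg' : ∀ y ∈ S.image f,
      Function.invFunOn f S y ∈ S ∧ f (Function.invFunOn f S y) = y := by
    intro y hy
    obtain ⟨x, hx, rfl⟩ := mem_image.1 hy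
    rw [hg hx]
    exact ⟨hx, rfl⟩
  refine ⟨?_, ⟨fun x hx => mem_image_of_mem f hx, fun l hl hlS _ => (h l hl hlS).1⟩,
    Function.invFunOn f S, fun x hx => hg hx, fun y hy => (hg' y hy).2,
    fun y hy => (hg' y hy).1, fun l hl hlS _ hprod => ?_⟩
  · rw [coe_image]
    exact hf.bijOn_image
  · have hmap : (l.map (Function.invFunOn f S)).map f = l := by
      rw [List.map_map]
      exact (List.map_congr_left fun y hy => (hg' y (hlS y hy)).2).trans (List.map_id l)
    refine (h _ ?_ ?_).2 (by rwa [hmap])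
    · exact List.Nodup.of_map f (by rwa [hmap])
    · intro x hx
      obtain ⟨y, hy, rfl⟩ := List.mem_map.1 hx
      exact (hg' y (hlS y hy)).1

/-- Any subset of size `k` of `(ℤ_m × H) \ {0}` is weakly Freiman isomorphic (of order
`k`) to a subset of size `k` of `(ℤ × H) \ {0}`, provided every prime factor of `m`
exceeds `k!/2`. -/
theorem product_weak_freiman_iso (m k : ℕ) (hm : 0 < m) (hk : 0 < k)
    (H : Type*) [Group H] [Fintype H]
    (hprime : ∀ p : ℕ, p.Prime → p ∣ m → Nat.factorial k < 2 * p)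
    (S : Finset (Multiplicative (ZMod m) × H))
    (hcard : S.card = k) (h1 : (1 : Multiplicative (ZMod m) × H) ∉ S) :
    ∃ (S' : Finset (Multiplicative ℤ × H))
      (f : Multiplicative (ZMod m) × H → Multiplicative ℤ × H),
      S'.card = k ∧ (1 : Multiplicative ℤ × H) ∉ S' ∧ IsWeakFreimanIso k S S' f := by
  classical
  obtain ⟨y, hy, hinj⟩ := exists_int_lift (ι := S) (m := m)
    (by simpa [hcard] using hprime) (fun s => s.1.1.toAdd)
  let f : Multiplicative (ZMod m) × H → Multiplicative ℤ × H := fun s =>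
    if hs : s ∈ S then (Multiplicative.ofAdd (y ⟨s, hs⟩), s.2) else 1
  have hfS : ∀ s (hs : s ∈ S), f s = (Multiplicative.ofAdd (y ⟨s, hs⟩), s.2) :=
    fun s hs => dif_pos hs
  have hf : Set.InjOn f S := by
    intro s hs t ht hst
    rw [hfS s hs, hfS t ht, Prod.mk.injEq] at hst
    exact Prod.ext (Multiplicative.toAdd.injective
      (hinj ⟨s, hs⟩ ⟨t, ht⟩ (Multiplicative.ofAdd.injective hst.1))) hst.2
  have hprod : ∀ l : List (Multiplicative (ZMod m) × H), l.Nodup → (∀ x ∈ l, x ∈ S) →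
      (l.prod = 1 ↔ (l.map f).prod = 1) := by
    intro l hl hlS
    obtain ⟨l, rfl⟩ : ∃ l' : List S, l'.map Subtype.val = l :=
      ⟨l.attachWith (· ∈ S) hlS, List.attachWith_map_subtype_val _⟩
    have hl' : l.Nodup := hl.of_map _
    have hmap : (l.map Subtype.val).map f =
        l.map fun s => (Multiplicative.ofAdd (y s), s.1.2) := by
      rw [List.map_map]
      exact List.map_congr_left fun s _ => hfS s.1 s.2
    have hsum := hy l.toFinset
    rw [List.sum_toFinset _ hl', List.sum_toFinset _ hl'] at hsum
    rw [hmap, list_prod_eq_one_iff, list_prod_eq_one_iff]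
    simp only [List.map_map]
    refine and_congr ?_ Iff.rfl
    rw [← toAdd_eq_zero, ← toAdd_eq_zero, toAdd_list_sum, toAdd_list_sum]
    simpa [List.map_map, Function.comp_def] using hsum
  refine ⟨S.image f, f, by rw [card_image_of_injOn hf, hcard], fun h => ?_,
    isWeakFreimanIso_image k S f hf hprod⟩
  obtain ⟨s, hs, hs1⟩ := mem_image.1 h
  have := (hprod [s] (List.nodup_singleton s) (by simpa using hs)).2 (by simpa using hs1)
  rw [List.prod_singleton] at this
  exact h1 (this ▸ hs)
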